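/- arXiv:1108.0431 — 9 statements merged into one kernel-verified Lean document; each statement's English description precedes it below -/
import Mathlib

section
/- Let Λ be an abelian group, R a Λ-graded associative ring, and 𝔖 a finite nonempty set of bijections of R, closed under composition, each element of which is a ring automorphism or a ring anti-automorphism preserving every homogeneous component R^λ. Then the following are equivalent: (a) every graded two-sided ideal I of R with s(I) ⊆ I for all s ∈ 𝔖 and with I·I = 0 is zero; (b) every graded two-sided ideal I of R with I·I = 0 is zero. -/
theorem coe_decompose_apply_of_map_mem {Λ : Type*} [DecidableEq Λ] {R : Type*} [AddCommGroup R]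
    (ℊ : Λ → AddSubgroup R) [DirectSum.Decomposition ℊ] (f : R →+ R)
    (hf : ∀ (lam : Λ) (x : R), x ∈ ℊ lam → f x ∈ ℊ lam) (x : R) (lam : Λ) :
    (DirectSum.decompose ℊ (f x) lam : R) = f (DirectSum.decompose ℊ x lam) := by
  induction x using DirectSum.Decomposition.inductionOn ℊ with
  | zero => simp
  | @homogeneous i m =>
    have hm := hf i m m.2
    by_cases h : i = lam
    · subst h
      rw [DirectSum.decompose_of_mem_same ℊ hm, DirectSum.decompose_of_mem_same ℊ m.2]
    · rw [DirectSum.decompose_of_mem_ne ℊ hm h, DirectSum.decompose_of_mem_ne ℊ m.2 h, map_zero]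
  | add a b ha hb => simp [DirectSum.decompose_add, ha, hb]

/-- The intersection of the images of `I` under the bijections in `T`. -/
def iInterImages {R : Type*} [Ring R] (I : AddSubgroup R) (T : Finset (R ≃ R)) : Set R :=
  {x | ∀ s ∈ T, s.symm x ∈ I}

theorem mul_mem_iInterImages {R : Type*} [Ring R] {I : AddSubgroup R} {T : Finset (R ≃ R)}
    (hI : ∀ r x : R, x ∈ I → r * x ∈ I ∧ x * r ∈ I)
    (hT : ∀ s ∈ T, (∀ a b : R, s (a * b) = s a * s b) ∨ (∀ a b : R, s (a * b) = s b * s a))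
    (r : R) {x : R} (hx : x ∈ iInterImages I T) :
    r * x ∈ iInterImages I T ∧ x * r ∈ iInterImages I T := by
  refine ⟨fun s hs => ?_, fun s hs => ?_⟩ <;> rcases hT s hs with h | h
  · rw [show s.symm (r * x) = s.symm r * s.symm x by simp [s.symm_apply_eq, h]]
    exact (hI _ _ (hx s hs)).1
  · rw [show s.symm (r * x) = s.symm x * s.symm r by simp [s.symm_apply_eq, h]]
    exact (hI _ _ (hx s hs)).2
  · rw [show s.symm (x * r) = s.symm x * s.symm r by simp [s.symm_apply_eq, h]]
    exact (hI _ _ (hx s hs)).2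
  · rw [show s.symm (x * r) = s.symm r * s.symm x by simp [s.symm_apply_eq, h]]
    exact (hI _ _ (hx s hs)).1

theorem mul_eq_zero_of_mem_iInterImages {R : Type*} [Ring R] {I : AddSubgroup R}
    {T : Finset (R ≃ R)} (hI : ∀ x ∈ I, ∀ y ∈ I, x * y = 0)
    (hadd : ∀ s ∈ T, ∀ a b : R, s (a + b) = s a + s b)
    (hT : ∀ s ∈ T, (∀ a b : R, s (a * b) = s a * s b) ∨ (∀ a b : R, s (a * b) = s b * s a))
    (hne : T.Nonempty) {x y : R} (hx : x ∈ iInterImages I T) (hy : y ∈ iInterImages I T) :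
    x * y = 0 := by
  obtain ⟨s, hs⟩ := hne
  have h0 : s 0 = 0 := by simpa using hadd s hs 0 0
  rcases hT s hs with h | h
  · simpa [hI _ (hx s hs) _ (hy s hs), h0] using (h (s.symm x) (s.symm y)).symm
  · simpa [hI _ (hy s hs) _ (hx s hs), h0] using (h (s.symm y) (s.symm x)).symm

theorem decompose_mem_iInterImages {Λ : Type*} [DecidableEq Λ] {R : Type*} [Ring R]
    (ℊ : Λ → AddSubgroup R) [DirectSum.Decomposition ℊ] {I : AddSubgroup R} {T : Finset (R ≃ R)}
    (hI : ∀ x ∈ I, ∀ lam : Λ, (DirectSum.decompose ℊ x lam : R) ∈ I)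
    (hadd : ∀ s ∈ T, ∀ a b : R, s (a + b) = s a + s b)
    (hgr : ∀ s ∈ T, ∀ (lam : Λ) (x : R), x ∈ ℊ lam → s x ∈ ℊ lam)
    {x : R} (hx : x ∈ iInterImages I T) (lam : Λ) :
    (DirectSum.decompose ℊ x lam : R) ∈ iInterImages I T := by
  intro s hs
  have h := coe_decompose_apply_of_map_mem ℊ (AddMonoidHom.mk' s (hadd s hs)) (hgr s hs)
    (s.symm x) lam
  simp only [AddMonoidHom.mk'_apply, s.apply_symm_apply] at h
  rw [h, s.symm_apply_apply]
  exact hI _ (hx s hs) lam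

open scoped Classical in
theorem apply_mem_iInterImages_image_trans {R : Type*} [Ring R] {I : AddSubgroup R}
    {T : Finset (R ≃ R)} (t : R ≃ R) {x : R} (hx : x ∈ iInterImages I T) :
    t x ∈ iInterImages I (T.image fun u => u.trans t) := by
  intro v hv
  obtain ⟨u, hu, rfl⟩ := Finset.mem_image.1 hv
  simpa using hx u hu

open scoped Classical in
/-- A largest set of bijections in `𝔖` for which the images of `I` still have a nonzero common
element. -/
theorem exists_maximal_iInterImages {R : Type*} [Ring R] {I : AddSubgroup R}
    {𝔖 : Finset (R ≃ R)} (hne : 𝔖.Nonempty)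
    (hadd : ∀ s ∈ 𝔖, ∀ a b : R, s (a + b) = s a + s b) (hI : I ≠ ⊥) :
    ∃ T ⊆ 𝔖, T.Nonempty ∧ (∃ x ∈ iInterImages I T, x ≠ 0) ∧
      ∀ U ⊆ 𝔖, T.card < U.card → ∀ x ∈ iInterImages I U, x = 0 := by
  obtain ⟨s, hs⟩ := hne
  obtain ⟨x, hx, hx0⟩ := I.bot_or_exists_ne_zero.resolve_left hI
  have h0 : s 0 = 0 := by simpa using hadd s hs 0 0
  have hmem : {s} ∈ 𝔖.powerset.filter fun T => ∃ x ∈ iInterImages I T, x ≠ 0 := by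
    simp only [Finset.mem_filter, Finset.mem_powerset, Finset.singleton_subset_iff]
    exact ⟨hs, s x, by simpa [iInterImages] using hx, fun h => hx0 (s.injective (h.trans h0.symm))⟩
  obtain ⟨T, hT, hmax⟩ := Finset.exists_max_image _ Finset.card ⟨_, hmem⟩
  obtain ⟨hTS, hTx⟩ := Finset.mem_filter.1 hT
  refine ⟨T, Finset.mem_powerset.1 hTS, Finset.card_pos.1 ?_, hTx, fun U hU hlt y hy => ?_⟩
  · exact lt_of_lt_of_le (by simp) (hmax _ hmem)
  · by_contra hy0
    exact absurd (hmax U (Finset.mem_filter.2 ⟨Finset.mem_powerset.2 hU, y, hy, hy0⟩))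
      (not_le.2 hlt)

theorem decompose_mem_closure {Λ : Type*} [DecidableEq Λ] {R : Type*} [AddCommGroup R]
    (ℊ : Λ → AddSubgroup R) [DirectSum.Decomposition ℊ] {A : Set R}
    (hA : ∀ x ∈ A, ∀ lam : Λ, (DirectSum.decompose ℊ x lam : R) ∈ A)
    {x : R} (hx : x ∈ AddSubgroup.closure A) (lam : Λ) :
    (DirectSum.decompose ℊ x lam : R) ∈ AddSubgroup.closure A := by
  induction hx using AddSubgroup.closure_induction with
  | mem x hx => exact AddSubgroup.subset_closure (hA x hx lam)
  | zero => simp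
  | add a b _ _ ha hb => simpa using add_mem ha hb
  | neg a _ ha =>
    rw [DirectSum.decompose_neg]
    exact neg_mem ha

theorem map_mem_closure_of_forall_mem {R : Type*} [AddCommGroup R] {A : Set R} (f : R →+ R)
    (hA : ∀ x ∈ A, f x ∈ A) {x : R} (hx : x ∈ AddSubgroup.closure A) :
    f x ∈ AddSubgroup.closure A :=
  (AddSubgroup.closure_le (AddSubgroup.comap f (AddSubgroup.closure A))).2
    (fun y hy => AddSubgroup.subset_closure (hA y hy)) hx

theorem mul_eq_zero_of_mem_closure {R : Type*} [Ring R] {A : Set R}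
    (hA : ∀ x ∈ A, ∀ y ∈ A, x * y = 0) {x y : R} (hx : x ∈ AddSubgroup.closure A)
    (hy : y ∈ AddSubgroup.closure A) : x * y = 0 := by
  induction hx, hy using AddSubgroup.closure_induction₂ with
  | mem x y hx hy => exact hA x hx y hy
  | zero_left => simp
  | zero_right => simp
  | add_left _ _ _ _ _ _ h1 h2 => simp [add_mul, h1, h2]
  | add_right _ _ _ _ _ _ h1 h2 => simp [mul_add, h1, h2]
  | neg_left _ _ _ _ h => simp [h]
  | neg_right _ _ _ _ h => simp [h]

/-- A graded two-sided ideal with trivial multiplication, in a `Λ`-graded ring. -/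
theorem graded_semiprime_iff_S_graded_semiprime
    {Λ : Type*} [AddCommGroup Λ] [DecidableEq Λ]
    {R : Type*} [Ring R] (ℊ : Λ → AddSubgroup R) [GradedRing ℊ]
    (𝔖 : Finset (R ≃ R)) (h𝔖ne : 𝔖.Nonempty)
    (h𝔖comp : ∀ s ∈ 𝔖, ∀ t ∈ 𝔖, s.trans t ∈ 𝔖)
    (h𝔖add : ∀ s ∈ 𝔖, ∀ a b : R, s (a + b) = s a + s b)
    (h𝔖mul : ∀ s ∈ 𝔖,
      (∀ a b : R, s (a * b) = s a * s b) ∨ (∀ a b : R, s (a * b) = s b * s a))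
    (h𝔖grade : ∀ s ∈ 𝔖, ∀ (lam : Λ) (x : R), x ∈ ℊ lam → s x ∈ ℊ lam) :
    (∀ I : AddSubgroup R,
        (∀ r x : R, x ∈ I → r * x ∈ I ∧ x * r ∈ I) →
        (∀ x ∈ I, ∀ lam : Λ, (DirectSum.decompose ℊ x lam : R) ∈ I) →
        (∀ s ∈ 𝔖, ∀ x ∈ I, s x ∈ I) →
        (∀ x ∈ I, ∀ y ∈ I, x * y = 0) → I = ⊥)
    ↔
    (∀ I : AddSubgroup R,
        (∀ r x : R, x ∈ I → r * x ∈ I ∧ x * r ∈ I) →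
        (∀ x ∈ I, ∀ lam : Λ, (DirectSum.decompose ℊ x lam : R) ∈ I) →
        (∀ x ∈ I, ∀ y ∈ I, x * y = 0) → I = ⊥) := by
  classical
  refine ⟨fun ha I hI hIgr hIsq => ?_, fun hb I hI hIgr _ hIsq => hb I hI hIgr hIsq⟩
  by_contra hI0
  obtain ⟨T, hTS, hTne, ⟨x, hx, hx0⟩, hmax⟩ := exists_maximal_iInterImages h𝔖ne h𝔖add hI0
  let tr (s : R ≃ R) : Finset (R ≃ R) := T.image fun u => u.trans s
  have htrS (s : R ≃ R) (hs : s ∈ 𝔖) : tr s ⊆ 𝔖 :=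
    Finset.image_subset_iff.2 fun u hu => h𝔖comp u (hTS hu) s hs
  have htrcard (s : R ≃ R) : (tr s).card = T.card :=
    Finset.card_image_of_injective _ fun u v huv => Equiv.ext fun a =>
      s.injective (DFunLike.congr_fun huv a)
  let A : Set R := {y | ∃ s ∈ 𝔖, y ∈ iInterImages I (tr s)}
  have hAmul (r : R) {y : R} (hy : y ∈ A) : r * y ∈ A ∧ y * r ∈ A := by
    obtain ⟨s, hs, hy⟩ := hy
    have h := mul_mem_iInterImages hI (fun u hu => h𝔖mul u (htrS s hs hu)) r hy
    exact ⟨⟨s, hs, h.1⟩, ⟨s, hs, h.2⟩⟩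
  have hAsq : ∀ y ∈ A, ∀ z ∈ A, y * z = 0 := by
    rintro y ⟨s, hs, hy⟩ z ⟨t, ht, hz⟩
    by_cases hst : tr s = tr t
    · exact mul_eq_zero_of_mem_iInterImages hIsq (fun u hu => h𝔖add u (htrS s hs hu))
        (fun u hu => h𝔖mul u (htrS s hs hu)) (hTne.image _) hy (hst ▸ hz)
    · refine hmax (tr s ∪ tr t) (Finset.union_subset (htrS s hs) (htrS t ht)) ?_ _ fun u hu => ?_
      · rw [← htrcard s]
        refine Finset.card_lt_card (Finset.ssubset_iff_subset_ne.2
          ⟨Finset.subset_union_left, fun h => hst ?_⟩)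
        exact (Finset.eq_of_subset_of_card_le (Finset.union_eq_left.1 h.symm)
          (by rw [htrcard, htrcard])).symm
      · rcases Finset.mem_union.1 hu with hu | hu
        · exact (mul_mem_iInterImages hI (fun u hu => h𝔖mul u (htrS s hs hu)) z hy).2 u hu
        · exact (mul_mem_iInterImages hI (fun u hu => h𝔖mul u (htrS t ht hu)) y hz).1 u hu
  have hbot : AddSubgroup.closure A = ⊥ := by
    refine ha _ (fun r y hy => ⟨?_, ?_⟩) (fun y hy lam => decompose_mem_closure ℊ ?_ hy lam)
      (fun s hs y hy => ?_) (fun y hy z hz => mul_eq_zero_of_mem_closure hAsq hy hz)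
    · exact map_mem_closure_of_forall_mem (AddMonoidHom.mulLeft r) (fun z hz => (hAmul r hz).1) hy
    · exact map_mem_closure_of_forall_mem (AddMonoidHom.mulRight r) (fun z hz => (hAmul r hz).2) hy
    · rintro z ⟨s, hs, hz⟩ mu
      exact ⟨s, hs, decompose_mem_iInterImages ℊ hIgr (fun u hu => h𝔖add u (htrS s hs hu))
        (fun u hu => h𝔖grade u (htrS s hs hu)) hz mu⟩
    · refine map_mem_closure_of_forall_mem (AddMonoidHom.mk' s (h𝔖add s hs)) ?_ hy
      rintro z ⟨t, ht, hz⟩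
      refine ⟨t.trans s, h𝔖comp t ht s hs, ?_⟩
      have h := apply_mem_iInterImages_image_trans s hz
      rwa [Finset.image_image] at h
  obtain ⟨s, hs⟩ := h𝔖ne
  have hsx : s x ∈ AddSubgroup.closure A :=
    AddSubgroup.subset_closure ⟨s, hs, apply_mem_iInterImages_image_trans s hx⟩
  rw [hbot, AddSubgroup.mem_bot] at hsx
  have h0 : s 0 = 0 := by simpa using h𝔖add s hs 0 0
  exact hx0 (s.injective (hsx.trans h0.symm))
end

section
/- Let Λ be a free abelian group and F a unital commutative Λ-graded ring such that every nonzero homogeneous element of F is invertible and F^λ ≠ 0 for every λ ∈ Λ. Then F^0 is a field, and there exists a ring isomorphism from the group algebra F^0[Λ] onto F which, for each λ ∈ Λ, carries the λ-th graded component of F^0[Λ] onto F^λ. -/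
open DirectSum

section GradedRing

variable {Λ : Type*} [AddCommGroup Λ] [DecidableEq Λ] {F : Type*} [CommRing F]
  (ℊ : Λ → AddSubgroup F) [GradedRing ℊ]

theorem GradedRing.inv_mem_neg {lam : Λ} {u : Fˣ} (hu : (u : F) ∈ ℊ lam) :
    ((u⁻¹ : Fˣ) : F) ∈ ℊ (-lam) := by
  have h : (u : F) * decompose ℊ ((u⁻¹ : Fˣ) : F) (-lam) = 1 := by
    rw [← coe_decompose_mul_add_of_left_mem ℊ hu, Units.mul_inv, add_neg_cancel,
      decompose_of_mem_same ℊ SetLike.GradedOne.one_mem]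
  rw [Units.inv_eq_of_mul_eq_one_right h]
  exact SetLike.coe_mem _

theorem GradedRing.isField_zero [Nontrivial F]
    (hdiv : ∀ x ∈ ℊ 0, x ≠ 0 → IsUnit x) : IsField (ℊ 0) where
  exists_pair_ne := ⟨0, 1, fun h => zero_ne_one (α := F) congr(($h : F))⟩
  mul_comm := mul_comm
  mul_inv_cancel {a} ha := by
    obtain ⟨u, hu⟩ := hdiv a a.2 (by simpa using ha)
    have hmem : (u : F) ∈ ℊ 0 := hu ▸ a.2
    refine ⟨⟨((u⁻¹ : Fˣ) : F), by simpa using inv_mem_neg ℊ hmem⟩, Subtype.ext ?_⟩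
    change (a : F) * ((u⁻¹ : Fˣ) : F) = 1
    rw [← hu, Units.mul_inv]

/-- If every component indexed by a free abelian group contains a unit, these units can be chosen
multiplicatively. -/
theorem GradedRing.exists_monoidHom_units [Module.Free ℤ Λ]
    (h : ∀ lam, ∃ u : Fˣ, (u : F) ∈ ℊ lam) :
    ∃ g : Multiplicative Λ →* Fˣ, ∀ lam, (g (.ofAdd lam) : F) ∈ ℊ lam := by
  choose u hu using h
  let b := Module.Free.chooseBasis ℤ Λ
  let g : Λ →ₗ[ℤ] Additive Fˣ := b.constr ℤ fun i => Additive.ofMul (u (b i))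
  let H : AddSubgroup Λ :=
    { carrier := {lam | ((g lam).toMul : F) ∈ ℊ lam}
      zero_mem' := by simpa using SetLike.GradedOne.one_mem (A := ℊ)
      add_mem' := fun {x y} hx hy => by
        simpa using SetLike.GradedMul.mul_mem (A := ℊ) hx hy
      neg_mem' := fun {x} hx => by simpa using inv_mem_neg ℊ hx }
  have hH : ∀ lam, lam ∈ AddSubgroup.toIntSubmodule H := by
    have : Submodule.span ℤ (Set.range b) ≤ AddSubgroup.toIntSubmodule H := by
      rw [Submodule.span_le]
      rintro _ ⟨i, rfl⟩
      change ((g (b i)).toMul : F) ∈ ℊ (b i)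
      simpa [g] using hu (b i)
    exact fun lam => this (b.mem_span lam)
  exact ⟨g.toAddMonoidHom.toMultiplicativeLeft, hH⟩

variable (g : Multiplicative Λ →* Fˣ)

/-- The homomorphism from the group algebra of the degree-zero part given by a multiplicative
family of units. -/
noncomputable def GradedRing.groupAlgebraHom : AddMonoidAlgebra (ℊ 0) Λ →+* F :=
  AddMonoidAlgebra.lift (ℊ 0) F Λ ((Units.coeHom F).comp g)

@[simp]
theorem GradedRing.groupAlgebraHom_single (lam : Λ) (c : ℊ 0) :
    groupAlgebraHom ℊ g (AddMonoidAlgebra.single lam c) = c * g (.ofAdd lam) := by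
  simp [groupAlgebraHom, Algebra.smul_def]

variable {g}

theorem GradedRing.decompose_groupAlgebraHom (hg : ∀ lam, (g (.ofAdd lam) : F) ∈ ℊ lam)
    (p : AddMonoidAlgebra (ℊ 0) Λ) (lam : Λ) :
    (decompose ℊ (groupAlgebraHom ℊ g p) lam : F) = p.coeff lam * g (.ofAdd lam) := by
  induction p using AddMonoidAlgebra.induction_linear with
  | zero => simp
  | add p q hp hq => simp [hp, hq, add_mul]
  | single mu c =>
    rw [groupAlgebraHom_single, coe_decompose_mul_of_left_mem_zero ℊ c.2,
      AddMonoidAlgebra.coeff_single]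
    by_cases h : mu = lam
    · subst h
      rw [decompose_of_mem_same ℊ (hg mu), Finsupp.single_eq_same]
    · rw [decompose_of_mem_ne ℊ (hg mu) h, Finsupp.single_eq_of_ne (Ne.symm h)]
      simp

theorem GradedRing.mem_iff_exists_groupAlgebraHom_single
    (hg : ∀ lam, (g (.ofAdd lam) : F) ∈ ℊ lam) (lam : Λ) (x : F) :
    x ∈ ℊ lam ↔ ∃ c : ℊ 0, groupAlgebraHom ℊ g (AddMonoidAlgebra.single lam c) = x := by
  constructor
  · intro hx
    refine ⟨⟨x * ((g (.ofAdd lam))⁻¹ : Fˣ), ?_⟩, by simp⟩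
    simpa only [add_neg_cancel] using
      SetLike.GradedMul.mul_mem (A := ℊ) hx (inv_mem_neg ℊ (hg lam))
  · rintro ⟨c, rfl⟩
    simpa using SetLike.GradedMul.mul_mem (A := ℊ) c.2 (hg lam)

theorem GradedRing.groupAlgebraHom_bijective (hg : ∀ lam, (g (.ofAdd lam) : F) ∈ ℊ lam) :
    Function.Bijective (groupAlgebraHom ℊ g) := by
  constructor
  · rw [injective_iff_map_eq_zero]
    intro p hp
    ext lam
    have h := decompose_groupAlgebraHom ℊ hg p lam
    rw [hp, decompose_zero, DirectSum.zero_apply, ZeroMemClass.coe_zero] at h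
    simpa using (Units.mul_left_eq_zero _).1 h.symm
  · intro x
    induction x using DirectSum.Decomposition.inductionOn ℊ with
    | zero => exact ⟨0, map_zero _⟩
    | homogeneous x =>
      obtain ⟨c, hc⟩ := (mem_iff_exists_groupAlgebraHom_single ℊ hg _ _).1 x.2
      exact ⟨_, hc⟩
    | add x y hx hy =>
      obtain ⟨p, rfl⟩ := hx
      obtain ⟨q, rfl⟩ := hy
      exact ⟨p + q, map_add _ p q⟩

end GradedRing



/-- A graded-field with full support over a free abelian group `Λ` has `F⁰` a field and is
graded-isomorphic to the group algebra `F⁰[Λ]`, the isomorphism matching the graded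
components. -/
theorem gradedField_free_iso_groupAlgebra
    {Λ : Type*} [AddCommGroup Λ] [DecidableEq Λ] [Module.Free ℤ Λ]
    {F : Type*} [CommRing F] (ℊ : Λ → AddSubgroup F) [GradedRing ℊ]
    (hdiv : ∀ (lam : Λ) (x : F), x ∈ ℊ lam → x ≠ 0 → IsUnit x)
    (hsupp : ∀ lam : Λ, ℊ lam ≠ ⊥) :
    IsField (ℊ 0) ∧
    ∃ e : AddMonoidAlgebra (ℊ 0) Λ ≃+* F,
      ∀ (lam : Λ) (x : F),
        x ∈ ℊ lam ↔ ∃ c : ℊ 0, e (AddMonoidAlgebra.single lam c) = x := by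
  have hex : ∀ lam, ∃ x ∈ ℊ lam, x ≠ 0 := fun lam =>
    (AddSubgroup.ne_bot_iff_exists_ne_zero.1 (hsupp lam)).elim fun x hx =>
      ⟨x, x.2, by simpa using hx⟩
  obtain ⟨x, -, hx⟩ := hex 0
  have : Nontrivial F := ⟨x, 0, hx⟩
  obtain ⟨g, hg⟩ := GradedRing.exists_monoidHom_units ℊ fun lam => by
    obtain ⟨x, hx, hx0⟩ := hex lam
    obtain ⟨u, rfl⟩ := hdiv lam x hx hx0
    exact ⟨u, hx⟩
  exact ⟨GradedRing.isField_zero ℊ (hdiv 0),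
    RingEquiv.ofBijective _ (GradedRing.groupAlgebraHom_bijective ℊ hg),
    GradedRing.mem_iff_exists_groupAlgebraHom_single ℊ hg⟩
end

section
/- Let Λ be an abelian group, D a commutative Λ-graded ring (not necessarily unital) with D·D ≠ 0, and σ a ring automorphism of D with σ∘σ = id and σ(D^λ) = D^λ for all λ ∈ Λ. Assume that the only graded ideals I of D satisfying σ(I) = I are 0 and D, while D possesses a graded ideal different from 0 and D. Then there exists a nonzero graded ideal B of D such that D = B ⊕ σ(B) as additive groups, B·σ(B) = 0, B·B ≠ 0, and the only graded ideals of D contained in B are 0 and B. -/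
/-- A degree-preserving additive endomorphism commutes with taking homogeneous components. -/
theorem coe_decompose_map_of_degree_preserving {ι M F : Type*} [DecidableEq ι] [AddCommGroup M]
    (ℊ : ι → AddSubgroup M) [DirectSum.Decomposition ℊ] [FunLike F M M] [AddMonoidHomClass F M M]
    (f : F) (hf : ∀ (i : ι) (x : M), x ∈ ℊ i → f x ∈ ℊ i) (x : M) (i : ι) :
    (DirectSum.decompose ℊ (f x) i : M) = f (DirectSum.decompose ℊ x i) := by
  induction x using DirectSum.Decomposition.inductionOn ℊ with
  | zero => simp
  | @homogeneous j m =>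
    by_cases h : j = i
    · subst h
      rw [DirectSum.decompose_of_mem_same ℊ (hf j m m.2),
        DirectSum.decompose_of_mem_same ℊ m.2]
    · rw [DirectSum.decompose_of_mem_ne ℊ (hf j m m.2) h,
        DirectSum.decompose_of_mem_ne ℊ m.2 h, map_zero]
  | add a b ha hb => simp [DirectSum.decompose_add, ha, hb]


/-- If a commutative (not necessarily unital) `Λ`-graded ring `D` with `D·D ≠ 0` and a
degree-preserving automorphism `σ` of period 2 is `σ`-graded-simple but not graded-simple,
then `D` splits as `B ⊕ σ(B)` for a minimal nonzero graded ideal `B` with `B·σ(B) = 0`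
and `B·B ≠ 0`. -/
theorem sigma_graded_simple_not_graded_simple_splits
    {Λ : Type*} [AddCommGroup Λ] [DecidableEq Λ]
    {D : Type*} [NonUnitalCommRing D] (ℊ : Λ → AddSubgroup D)
    [DirectSum.Decomposition ℊ] [SetLike.GradedMul ℊ]
    (σ : D ≃+* D) (hσ2 : ∀ x, σ (σ x) = x)
    (hσg : ∀ (lam : Λ) (x : D), x ∈ ℊ lam → σ x ∈ ℊ lam)
    (hDD : ∃ a b : D, a * b ≠ 0)
    (hσsimple : ∀ I : AddSubgroup D,
        (∀ r x : D, x ∈ I → r * x ∈ I) →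
        (∀ x ∈ I, ∀ lam : Λ, (DirectSum.decompose ℊ x lam : D) ∈ I) →
        (∀ x ∈ I, σ x ∈ I) → I = ⊥ ∨ I = ⊤)
    (hnotsimple : ∃ J : AddSubgroup D,
        (∀ r x : D, x ∈ J → r * x ∈ J) ∧
        (∀ x ∈ J, ∀ lam : Λ, (DirectSum.decompose ℊ x lam : D) ∈ J) ∧
        J ≠ ⊥ ∧ J ≠ ⊤) :
    ∃ B : AddSubgroup D,
      (∀ r x : D, x ∈ B → r * x ∈ B) ∧
      (∀ x ∈ B, ∀ lam : Λ, (DirectSum.decompose ℊ x lam : D) ∈ B) ∧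
      B ≠ ⊥ ∧
      (∀ x : D, ∃ b ∈ B, ∃ b' ∈ B, x = b + σ b') ∧
      (∀ x : D, x ∈ B → (∃ b ∈ B, x = σ b) → x = 0) ∧
      (∀ b ∈ B, ∀ b' ∈ B, b * σ b' = 0) ∧
      (∃ b ∈ B, ∃ b' ∈ B, b * b' ≠ 0) ∧
      (∀ I : AddSubgroup D,
        (∀ r x : D, x ∈ I → r * x ∈ I) →
        (∀ x ∈ I, ∀ lam : Λ, (DirectSum.decompose ℊ x lam : D) ∈ I) →
        I ≤ B → I = ⊥ ∨ I = B) := by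
  have split : ∀ I : AddSubgroup D, (∀ r x : D, x ∈ I → r * x ∈ I) →
      (∀ x ∈ I, ∀ lam : Λ, (DirectSum.decompose ℊ x lam : D) ∈ I) → I ≠ ⊥ → I ≠ ⊤ →
      (∀ x : D, ∃ b ∈ I, ∃ b' ∈ I, x = b + σ b') ∧ ∀ x ∈ I, σ x ∈ I → x = 0 := by
    intro I hmul hgr hbot htop
    have hgrσ : ∀ x : D, σ x ∈ I → ∀ lam : Λ, σ (DirectSum.decompose ℊ x lam) ∈ I :=
      fun x hx lam ↦ coe_decompose_map_of_degree_preserving ℊ σ hσg x lam ▸ hgr _ hx lam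
    let σI : AddSubgroup D := I.comap (σ : D →+ D)
    have mem_σI (x : D) : x ∈ σI ↔ σ x ∈ I := Iff.rfl
    constructor
    · have hsup : I ⊔ σI = ⊤ := by
        refine (hσsimple (I ⊔ σI) ?_ ?_ ?_).resolve_left
          fun h ↦ hbot (le_bot_iff.mp (le_sup_left.trans h.le))
        · intro r x hx
          obtain ⟨y, hy, z, hz, rfl⟩ := AddSubgroup.mem_sup.mp hx
          rw [mul_add]
          refine AddSubgroup.add_mem_sup (hmul r y hy) ?_
          rw [mem_σI, map_mul]
          exact hmul _ _ hz
        · intro x hx lam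
          obtain ⟨y, hy, z, hz, rfl⟩ := AddSubgroup.mem_sup.mp hx
          rw [DirectSum.decompose_add, DirectSum.add_apply, AddSubgroup.coe_add]
          exact AddSubgroup.add_mem_sup (hgr y hy lam) (hgrσ z hz lam)
        · intro x hx
          obtain ⟨y, hy, z, hz, rfl⟩ := AddSubgroup.mem_sup.mp hx
          rw [map_add, add_comm]
          exact AddSubgroup.add_mem_sup hz ((mem_σI _).mpr ((hσ2 y).symm ▸ hy))
      intro x
      obtain ⟨y, hy, z, hz, rfl⟩ := AddSubgroup.mem_sup.mp (hsup ▸ AddSubgroup.mem_top x)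
      exact ⟨y, hy, σ z, hz, by rw [hσ2]⟩
    · have hinf : I ⊓ σI = ⊥ := by
        refine (hσsimple (I ⊓ σI) ?_ ?_ ?_).resolve_right
          fun h ↦ htop (top_le_iff.mp (h.ge.trans inf_le_left))
        · intro r x hx
          refine ⟨hmul r x hx.1, (mem_σI _).mpr ?_⟩
          rw [map_mul]
          exact hmul _ _ hx.2
        · exact fun x hx lam ↦ ⟨hgr x hx.1 lam, hgrσ x hx.2 lam⟩
        · exact fun x hx ↦ ⟨hx.2, (mem_σI _).mpr ((hσ2 x).symm ▸ hx.1)⟩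
      intro x hx hσx
      exact (AddSubgroup.mem_bot).mp (hinf ▸ (⟨hx, hσx⟩ : x ∈ I ⊓ σI))
  obtain ⟨B, hmul, hgr, hbot, htop⟩ := hnotsimple
  obtain ⟨hsum, hdisj⟩ := split B hmul hgr hbot htop
  have hcross : ∀ b ∈ B, ∀ b' ∈ B, b * σ b' = 0 := by
    intro b hb b' hb'
    refine hdisj _ (mul_comm b (σ b') ▸ hmul _ _ hb) ?_
    rw [map_mul, hσ2]
    exact hmul _ _ hb'
  refine ⟨B, hmul, hgr, hbot, hsum, ?_, hcross, ?_, ?_⟩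
  · rintro _ hx ⟨b, hb, rfl⟩
    exact hdisj _ hx ((hσ2 b).symm ▸ hb)
  · by_contra! hBB
    obtain ⟨x, y, hxy⟩ := hDD
    obtain ⟨a, ha, a', ha', rfl⟩ := hsum x
    obtain ⟨b, hb, b', hb', rfl⟩ := hsum y
    apply hxy
    rw [add_mul, mul_add, mul_add, hBB a ha b hb, hcross a ha b' hb', mul_comm (σ a') b,
      hcross b hb a' ha', ← map_mul, hBB a' ha' b' hb']
    simp
  · intro I hImul hIgr hIB
    refine or_iff_not_imp_left.mpr fun hIbot ↦ le_antisymm hIB fun x hx ↦ ?_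
    have hItop : I ≠ ⊤ := fun h ↦ htop (top_le_iff.mp (h.ge.trans hIB))
    obtain ⟨i, hi, i', hi', rfl⟩ := (split I hImul hIgr hIbot hItop).1 x
    have hσi' : σ i' ∈ B := (add_mem_cancel_left (hIB hi)).mp hx
    rw [hdisj _ hσi' ((hσ2 i').symm ▸ hIB hi'), add_zero]
    exact hi
end

section
/- Let k be a commutative ring, C a unital associative k-algebra with involution π, C₀ an ample subspace of (C, π) that generates C as a k-algebra, and R a two-sided ideal of C with π(R) = R and R ∩ C₀ = 0. Then for all r ∈ R, c ∈ C and c₀ ∈ C₀ the following hold: π(r) = −r, r² = 0, r·π(r) = 0, r·c₀·π(r) = 0, r·(π(c) − c) = 0, and r·c = c·r; in particular R is a central ideal of C. -/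
/-- If `C₀` is an ample subspace of `(C, π)` generating `C` as a `k`-algebra and `R` is a
`π`-invariant two-sided ideal of `C` with `R ∩ C₀ = 0`, then `π(r) = -r`, `r² = 0`,
`r·π(r) = 0`, `r·c₀·π(r) = 0`, `r·(π(c) - c) = 0` and `r` is central, for all `r ∈ R`. -/
theorem ample_complement_ideal_is_central
    {k : Type*} [CommRing k] {C : Type*} [Ring C] [Algebra k C]
    (π : C → C)
    (hπadd : ∀ a b : C, π (a + b) = π a + π b)
    (hπsmul : ∀ (c : k) (a : C), π (c • a) = c • π a)
    (hπmul : ∀ a b : C, π (a * b) = π b * π a)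
    (hπone : π 1 = 1)
    (hπinv : ∀ a : C, π (π a) = a)
    (C₀ : Submodule k C)
    (hone : (1 : C) ∈ C₀)
    (hsym : ∀ c₀ ∈ C₀, π c₀ = c₀)
    (hample : ∀ (c : C), ∀ c₀ ∈ C₀, c * c₀ * π c ∈ C₀)
    (hgen : Algebra.adjoin k (C₀ : Set C) = ⊤)
    (R : AddSubgroup C)
    (hideal : ∀ c x : C, x ∈ R → c * x ∈ R ∧ x * c ∈ R)
    (hπR : ∀ x ∈ R, π x ∈ R)
    (hRC₀ : ∀ x : C, x ∈ R → x ∈ C₀ → x = 0) :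
    ∀ r ∈ R, ∀ c : C, ∀ c₀ ∈ C₀,
      π r = -r ∧ r * r = 0 ∧ r * π r = 0 ∧ r * c₀ * π r = 0 ∧
      r * (π c - c) = 0 ∧ r * c = c * r := by
  have htrace : ∀ c : C, c + π c ∈ C₀ := fun c => by
    have h := C₀.sub_mem (C₀.sub_mem (hample (1 + c) 1 hone) hone) (hample c 1 hone)
    have e : (1 + c) * 1 * π (1 + c) - 1 - c * 1 * π c = c + π c := by
      rw [hπadd, hπone]; noncomm_ring
    rwa [e] at h
  have hneg : ∀ r ∈ R, π r = -r := fun r hr =>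
    (neg_eq_of_add_eq_zero_right
      (hRC₀ _ (R.add_mem hr (hπR r hr)) (htrace r))).symm
  have hnorm : ∀ r ∈ R, ∀ c₀ ∈ C₀, r * c₀ * π r = 0 := fun r hr c₀ hc₀ =>
    hRC₀ _ (hideal _ _ (hπR r hr)).1 (hample r c₀ hc₀)
  have hswap : ∀ r ∈ R, ∀ c : C, r * c = π c * r := fun r hr c => by
    have h := hneg _ (hideal c r hr).2
    rw [hπmul, hneg r hr, mul_neg, neg_inj] at h
    exact h.symm
  have hcomm : ∀ r ∈ R, ∀ c : C, r * c = c * r := fun r hr c => by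
    have hle : Algebra.adjoin k (C₀ : Set C) ≤ Subalgebra.centralizer k {r} :=
      Algebra.adjoin_le fun c₀ hc₀ => by
        rw [SetLike.mem_coe, Subalgebra.mem_centralizer_iff]
        rintro _ rfl
        rw [hswap _ hr, hsym c₀ hc₀]
    exact (Subalgebra.mem_centralizer_iff k).1 (hle (hgen ▸ Algebra.mem_top)) r rfl
  intro r hr c c₀ hc₀
  have hrr : r * π r = 0 := by simpa using hnorm r hr 1 hone
  refine ⟨hneg r hr, ?_, hrr, hnorm r hr c₀ hc₀, ?_, hcomm r hr c⟩
  · rwa [hneg r hr, mul_neg, neg_eq_zero] at hrr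
  · rw [mul_sub, sub_eq_zero, hcomm r hr (π c), hswap r hr c]
end

section
/- Let k be a commutative ring and C a unital associative k-algebra with involution π which is generated as a k-algebra by a set of π-symmetric elements (elements h with π(h) = h). Then the two-sided ideal of C generated by {c − π(c) : c ∈ C} equals the two-sided ideal of C generated by all commutators {ab − ba : a, b ∈ C}, and this ideal is invariant under π. -/
/-- The smallest two-sided ideal of `C` containing a set `S`. -/
def twoSidedSpan {C : Type*} [Ring C] (S : Set C) : AddSubgroup C :=
  sInf {I : AddSubgroup C | (∀ r x : C, x ∈ I → r * x ∈ I ∧ x * r ∈ I) ∧ S ⊆ I}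

section twoSidedSpan

variable {C : Type*} [Ring C] {S : Set C}

theorem mem_twoSidedSpan_of_mem {x : C} (hx : x ∈ S) : x ∈ twoSidedSpan S :=
  AddSubgroup.mem_sInf.2 fun _ hI => hI.2 hx

theorem twoSidedSpan_mul_mem_left (r : C) {x : C} (hx : x ∈ twoSidedSpan S) :
    r * x ∈ twoSidedSpan S :=
  AddSubgroup.mem_sInf.2 fun I hI => (hI.1 r x (AddSubgroup.mem_sInf.1 hx I hI)).1

theorem twoSidedSpan_mul_mem_right (r : C) {x : C} (hx : x ∈ twoSidedSpan S) :
    x * r ∈ twoSidedSpan S :=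
  AddSubgroup.mem_sInf.2 fun I hI => (hI.1 r x (AddSubgroup.mem_sInf.1 hx I hI)).2

theorem twoSidedSpan_le {I : AddSubgroup C}
    (hI : ∀ r x : C, x ∈ I → r * x ∈ I ∧ x * r ∈ I) (hS : S ⊆ I) : twoSidedSpan S ≤ I :=
  sInf_le ⟨hI, hS⟩

theorem twoSidedSpan_le_twoSidedSpan {T : Set C} (h : ∀ x ∈ S, x ∈ twoSidedSpan T) :
    twoSidedSpan S ≤ twoSidedSpan T :=
  twoSidedSpan_le
    (fun r _ hx => ⟨twoSidedSpan_mul_mem_left r hx, twoSidedSpan_mul_mem_right r hx⟩) h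

end twoSidedSpan

/-- If `C` is generated as a `k`-algebra by `π`-symmetric elements, then the two-sided
ideal generated by the skew elements `c - π(c)` equals the two-sided ideal generated by
all commutators, and this ideal is `π`-invariant. -/
theorem skew_ideal_eq_commutator_ideal
    {k : Type*} [CommRing k] {C : Type*} [Ring C] [Algebra k C]
    (π : C → C)
    (hπadd : ∀ a b : C, π (a + b) = π a + π b)
    (hπsmul : ∀ (c : k) (a : C), π (c • a) = c • π a)
    (hπmul : ∀ a b : C, π (a * b) = π b * π a)
    (hπone : π 1 = 1)
    (hπinv : ∀ a : C, π (π a) = a)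
    (S : Set C) (hS : ∀ h ∈ S, π h = h) (hgen : Algebra.adjoin k S = ⊤) :
    twoSidedSpan {x : C | ∃ c : C, x = c - π c}
      = twoSidedSpan {x : C | ∃ a b : C, x = a * b - b * a}
    ∧ ∀ x ∈ twoSidedSpan {x : C | ∃ c : C, x = c - π c},
        π x ∈ twoSidedSpan {x : C | ∃ c : C, x = c - π c} := by
  refine ⟨le_antisymm (twoSidedSpan_le_twoSidedSpan ?_) (twoSidedSpan_le_twoSidedSpan ?_), ?_⟩
  · rintro _ ⟨c, rfl⟩
    have hc : c ∈ Algebra.adjoin k S := hgen ▸ Algebra.mem_top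
    induction hc using Algebra.adjoin_induction with
    | mem x hx => simp [hS x hx]
    | algebraMap r => simp [Algebra.algebraMap_eq_smul_one, hπsmul, hπone]
    | add a b _ _ ha hb =>
      rw [hπadd, add_sub_add_comm]
      exact add_mem ha hb
    | mul a b _ _ ha hb =>
      have key : a * b - π (a * b) = (a * b - b * a) + b * (a - π a) + (b - π b) * π a := by
        rw [hπmul]
        noncomm_ring
      rw [key]
      exact add_mem (add_mem (mem_twoSidedSpan_of_mem ⟨a, b, rfl⟩) (twoSidedSpan_mul_mem_left _ ha))
        (twoSidedSpan_mul_mem_right _ hb)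
  · rintro _ ⟨a, b, rfl⟩
    have key : a * b - b * a = (a * b - π (a * b)) - b * (a - π a) - (b - π b) * π a := by
      rw [hπmul]
      noncomm_ring
    rw [key]
    exact sub_mem (sub_mem (mem_twoSidedSpan_of_mem ⟨_, rfl⟩)
      (twoSidedSpan_mul_mem_left _ (mem_twoSidedSpan_of_mem ⟨_, rfl⟩)))
      (twoSidedSpan_mul_mem_right _ (mem_twoSidedSpan_of_mem ⟨_, rfl⟩))
  · intro x hx
    have hskew : x - π x ∈ twoSidedSpan {x : C | ∃ c : C, x = c - π c} :=
      mem_twoSidedSpan_of_mem ⟨x, rfl⟩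
    simpa using sub_mem hx hskew
end

section
/- Let k be a commutative ring, Λ an abelian group, M = ⊕_{λ∈Λ} M^λ and N = ⊕_{λ∈Λ} N^λ graded k-modules, and Q : M → N a graded quadratic map. Then: (i) the k-submodule {m ∈ M : B(m, m') = 0 for all m' ∈ M} is graded, i.e. contains all homogeneous components of each of its elements; (ii) if m ∈ M satisfies B(m, m') = 0 for all m' ∈ M and m = Σ_λ m^λ is its decomposition into homogeneous components, then Q(m) = Σ_λ Q(m^λ); (iii) if 2 is invertible in k, or if Λ has no 2-torsion (2λ = 2μ implies λ = μ), then the radical {m ∈ M : Q(m) = 0 and B(m, m') = 0 for all m' ∈ M} is a graded submodule of M. -/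
/-- Homogeneous elements of pairwise distinct degrees with vanishing sum are all zero. -/
theorem DirectSum.Decomposition.eq_zero_of_sum_eq_zero
    {k Λ ι N : Type*} [CommRing k] [DecidableEq Λ] [AddCommGroup N] [Module k N]
    (𝒩 : Λ → Submodule k N) [DirectSum.Decomposition 𝒩] {d : ι → Λ} (hd : Function.Injective d)
    {f : ι → N} (hf : ∀ i, f i ∈ 𝒩 (d i)) {s : Finset ι} (h : ∑ i ∈ s, f i = 0)
    {i : ι} (hi : i ∈ s) : f i = 0 := by
  have key : ((DirectSum.decompose 𝒩 (∑ j ∈ s, f j) (d i) : 𝒩 (d i)) : N) = f i := by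
    rw [DirectSum.decompose_sum, DFinsupp.finsetSum_apply, AddSubmonoidClass.coe_finsetSum,
      Finset.sum_eq_single_of_mem i hi, DirectSum.decompose_of_mem_same 𝒩 (hf i)]
    intro j _ hji
    exact DirectSum.decompose_of_mem_ne 𝒩 (hf j) (hd.ne hji)
  rw [← key, h, DirectSum.decompose_zero]
  rfl

/-- A quadratic map is additive on a finite family of elements orthogonal to everything. -/
theorem QuadraticMap.map_finset_sum_of_polar_eq_zero
    {k ι M N : Type*} [CommRing k] [AddCommGroup M] [Module k M] [AddCommGroup N] [Module k N]
    (Q : QuadraticMap k M N) {f : ι → M} (hf : ∀ i m, QuadraticMap.polar Q (f i) m = 0)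
    (s : Finset ι) : Q (∑ i ∈ s, f i) = ∑ i ∈ s, Q (f i) := by
  classical
  induction s using Finset.induction_on with
  | empty => simp
  | insert i s hi ih =>
    rw [Finset.sum_insert hi, Finset.sum_insert hi, QuadraticMap.map_add Q, hf, ih, add_zero]

/-- An element is the sum of its homogeneous components over any finite set of degrees
outside of which they vanish. -/
theorem DirectSum.Decomposition.sum_decompose_eq
    {k Λ M : Type*} [CommRing k] [DecidableEq Λ] [AddCommGroup M] [Module k M]
    (ℳ : Λ → Submodule k M) [DirectSum.Decomposition ℳ] {m : M} {s : Finset Λ}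
    (hs : ∀ lam ∉ s, ((DirectSum.decompose ℳ m lam : ℳ lam) : M) = 0) :
    ∑ lam ∈ s, ((DirectSum.decompose ℳ m lam : ℳ lam) : M) = m := by
  classical
  conv_rhs => rw [← DirectSum.sum_support_decompose ℳ m]
  refine (Finset.sum_subset (fun lam hlam => ?_) fun lam _ hlam => ?_).symm
  · by_contra h
    exact DFinsupp.mem_support_iff.mp hlam (Subtype.ext (hs lam h))
  · rw [DFinsupp.notMem_support_iff.mp hlam, ZeroMemClass.coe_zero]


/-- For a graded quadratic map `Q` between graded modules:
(i) the kernel of the polar form is a graded submodule;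
(ii) `Q` is additive on the homogeneous components of elements in that kernel;
(iii) if `2` is invertible in `k` or `Λ` has no 2-torsion, the radical of `Q` is graded. -/
theorem graded_quadratic_map_radical_graded
    {k : Type*} [CommRing k] {Λ : Type*} [AddCommGroup Λ] [DecidableEq Λ]
    {M N : Type*} [AddCommGroup M] [Module k M] [AddCommGroup N] [Module k N]
    (ℳ : Λ → Submodule k M) [DirectSum.Decomposition ℳ]
    (𝒩 : Λ → Submodule k N) [DirectSum.Decomposition 𝒩]
    (Q : QuadraticMap k M N)
    (hQ : ∀ (lam : Λ), ∀ m ∈ ℳ lam, Q m ∈ 𝒩 (lam + lam))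
    (hB : ∀ (lam mu : Λ), ∀ m ∈ ℳ lam, ∀ m' ∈ ℳ mu,
      QuadraticMap.polar Q m m' ∈ 𝒩 (lam + mu)) :
    (∀ m : M, (∀ m' : M, QuadraticMap.polar Q m m' = 0) →
      ∀ (lam : Λ) (m' : M),
        QuadraticMap.polar Q ((DirectSum.decompose ℳ m lam : ℳ lam) : M) m' = 0)
    ∧
    (∀ m : M, (∀ m' : M, QuadraticMap.polar Q m m' = 0) →
      ∀ s : Finset Λ, (∀ lam ∉ s, ((DirectSum.decompose ℳ m lam : ℳ lam) : M) = 0) →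
        Q m = ∑ lam ∈ s, Q ((DirectSum.decompose ℳ m lam : ℳ lam) : M))
    ∧
    ((IsUnit (2 : k) ∨ ∀ lam mu : Λ, lam + lam = mu + mu → lam = mu) →
      ∀ m : M, Q m = 0 → (∀ m' : M, QuadraticMap.polar Q m m' = 0) →
        ∀ lam : Λ,
          Q ((DirectSum.decompose ℳ m lam : ℳ lam) : M) = 0 ∧
          ∀ m' : M,
            QuadraticMap.polar Q ((DirectSum.decompose ℳ m lam : ℳ lam) : M) m' = 0) := by
  classical
  have component_polar : ∀ m : M, (∀ m' : M, QuadraticMap.polar Q m m' = 0) →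
      ∀ (lam : Λ) (m' : M),
        QuadraticMap.polar Q ((DirectSum.decompose ℳ m lam : ℳ lam) : M) m' = 0 := by
    intro m hm lam m'
    induction m' using DirectSum.Decomposition.inductionOn ℳ with
    | zero => exact Q.polar_zero_right _
    | add a b ha hb => rw [QuadraticMap.polar_add_right, ha, hb, add_zero]
    | @homogeneous mu a =>
      by_cases hlam : lam ∈ (DirectSum.decompose ℳ m).support
      · refine DirectSum.Decomposition.eq_zero_of_sum_eq_zero 𝒩 (d := fun nu => nu + mu)
          (f := fun nu => QuadraticMap.polar Q ((DirectSum.decompose ℳ m nu : ℳ nu) : M) a)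
          (add_left_injective mu) (fun nu => hB _ _ _ (SetLike.coe_mem _) _ a.2) ?_ hlam
        have h := hm a
        rw [← DirectSum.sum_support_decompose ℳ m] at h
        simpa only [← QuadraticMap.polarBilin_apply_apply, map_sum, LinearMap.sum_apply] using h
      · rw [DFinsupp.notMem_support_iff.mp hlam, ZeroMemClass.coe_zero, Q.polar_zero_left]
  have map_eq_sum : ∀ m : M, (∀ m' : M, QuadraticMap.polar Q m m' = 0) →
      ∀ s : Finset Λ, (∀ lam ∉ s, ((DirectSum.decompose ℳ m lam : ℳ lam) : M) = 0) →
        Q m = ∑ lam ∈ s, Q ((DirectSum.decompose ℳ m lam : ℳ lam) : M) := by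
    intro m hm s hs
    rw [← Q.map_finset_sum_of_polar_eq_zero (component_polar m hm),
      DirectSum.Decomposition.sum_decompose_eq ℳ hs]
  refine ⟨component_polar, map_eq_sum, fun h m hQm hm lam => ⟨?_, component_polar m hm lam⟩⟩
  rcases h with h2 | hinj
  · have h := component_polar m hm lam (DirectSum.decompose ℳ m lam : ℳ lam)
    rw [QuadraticMap.polar_self, ← Nat.cast_smul_eq_nsmul k] at h
    exact h2.smul_eq_zero.mp (by exact_mod_cast h)
  · by_cases hlam : lam ∈ (DirectSum.decompose ℳ m).support
    · refine DirectSum.Decomposition.eq_zero_of_sum_eq_zero 𝒩 (d := fun nu => nu + nu)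
        (f := fun nu => Q ((DirectSum.decompose ℳ m nu : ℳ nu) : M))
        (fun a b hab => hinj a b hab) (fun nu => hQ _ _ (SetLike.coe_mem _)) ?_ hlam
      rw [← map_eq_sum m hm _ fun nu hnu => ?_, hQm]
      rw [DFinsupp.notMem_support_iff.mp hnu, ZeroMemClass.coe_zero]
    · rw [DFinsupp.notMem_support_iff.mp hlam, ZeroMemClass.coe_zero, Q.map_zero]
end

section
/- Let Λ be a torsion-free abelian group, R a Λ-graded ring, and S a graded additive subgroup of R, i.e. S contains all homogeneous components of each of its elements. If the only homogeneous element s ∈ S with s² = 0 is s = 0, then the only element s ∈ S with s² = 0 is s = 0. -/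
/-- A torsion-free abelian group has two unique sums, because it embeds into its divisible hull,
which is a vector space over `ℚ`. -/
theorem TwoUniqueSums.of_isAddTorsionFree (G : Type*) [AddCommGroup G] [IsAddTorsionFree G] :
    TwoUniqueSums G :=
  .of_injective_addHom (DivisibleHull.coeAddMonoidHom G).toAddHom
    DivisibleHull.coe_injective inferInstance

/-- In a commutative semigroup with unique sums, a nonempty finite set `A` contains an element
`a` such that `a + a` is attained only once as a sum of two elements of `A`. -/
theorem UniqueSums.exists_uniqueAdd_self {G : Type*} [AddCommSemigroup G] [UniqueSums G]
    {A : Finset G} (hA : A.Nonempty) : ∃ a ∈ A, UniqueAdd A A a a := by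
  obtain ⟨a, ha, b, hb, h⟩ := UniqueSums.uniqueAdd_of_nonempty hA hA
  obtain rfl : b = a := (h hb ha (add_comm b a)).1
  exact ⟨b, ha, h⟩

/-- If `a + a` is attained only once as a sum of two degrees in the support of `s`, then the
component of `s * s` of degree `a + a` is the square of the component of `s` of degree `a`. -/
theorem GradedRing.coe_decompose_mul_self_of_uniqueAdd {Λ R σ : Type*} [AddMonoid Λ]
    [DecidableEq Λ] [Semiring R] [SetLike σ R] [AddSubmonoidClass σ R] (ℊ : Λ → σ) [GradedRing ℊ]
    [∀ i (x : ℊ i), Decidable (x ≠ 0)] {s : R} {a : Λ}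
    (ha : a ∈ (DirectSum.decompose ℊ s).support)
    (h : UniqueAdd (DirectSum.decompose ℊ s).support (DirectSum.decompose ℊ s).support a a) :
    (DirectSum.decompose ℊ (s * s) (a + a) : R) =
      DirectSum.decompose ℊ s a * DirectSum.decompose ℊ s a := by
  rw [DirectSum.decompose_mul, DirectSum.coe_mul_apply, Finset.sum_eq_single (a, a)]
  · rintro ⟨i, j⟩ hij hne
    simp only [Finset.mem_filter, Finset.mem_product] at hij
    obtain ⟨rfl, rfl⟩ := h hij.1.1 hij.1.2 hij.2
    exact absurd rfl hne
  · intro hmem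
    exact (hmem (Finset.mem_filter.2 ⟨Finset.mk_mem_product ha ha, rfl⟩)).elim

/-- In a ring graded by a torsion-free abelian group, if a graded additive subgroup `S`
contains no nonzero homogeneous element of square zero, then it contains no nonzero
element of square zero at all. -/
theorem no_square_zero_of_no_homogeneous_square_zero
    {Λ : Type*} [AddCommGroup Λ] [DecidableEq Λ]
    (htf : ∀ (n : ℕ), 0 < n → ∀ lam : Λ, n • lam = 0 → lam = 0)
    {R : Type*} [Ring R] (ℊ : Λ → AddSubgroup R) [GradedRing ℊ]
    (S : AddSubgroup R)
    (hSgr : ∀ x ∈ S, ∀ lam : Λ, (DirectSum.decompose ℊ x lam : R) ∈ S)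
    (hhom : ∀ (lam : Λ) (s : R), s ∈ S → s ∈ ℊ lam → s * s = 0 → s = 0) :
    ∀ s ∈ S, s * s = 0 → s = 0 := by
  classical
  intro s hs hss
  have : IsAddTorsionFree Λ := ⟨fun n hn x y hxy => sub_eq_zero.1 <|
    htf n (Nat.pos_of_ne_zero hn) _ <| by rw [nsmul_sub]; exact sub_eq_zero.2 hxy⟩
  have := TwoUniqueSums.of_isAddTorsionFree Λ
  by_contra hne
  have hsupp : (DirectSum.decompose ℊ s).support.Nonempty := by
    rw [Finset.nonempty_iff_ne_empty, Ne, DFinsupp.support_eq_empty]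
    exact fun h => hne <|
      (DirectSum.decompose ℊ).injective (h.trans (DirectSum.decompose_zero ℊ).symm)
  obtain ⟨a, ha, huniq⟩ := UniqueSums.exists_uniqueAdd_self hsupp
  have hsq := GradedRing.coe_decompose_mul_self_of_uniqueAdd ℊ ha huniq
  rw [hss, DirectSum.decompose_zero, DirectSum.zero_apply, ZeroMemClass.coe_zero] at hsq
  exact DFinsupp.mem_support_iff.1 ha <| Subtype.ext <|
    hhom a _ (hSgr s hs a) (SetLike.coe_mem _) hsq.symm
end

section
/- Let k be a commutative ring in which 2 and 3 are invertible and A a unital associative k-algebra with k-linear involution π. Then 𝔰𝔲₂(A,π) = {X ∈ 𝔭₂(A,π) : tr(X) ∈ [A,A]} equals [𝔭₂(A,π), 𝔭₂(A,π)], the k-span of all commutators XY − YX with X, Y ∈ 𝔭₂(A,π). -/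
/-- The `π`-conjugate transpose of a matrix: transpose with `π` applied entrywise. -/
def conjT {A : Type*} {m n : Type*} (π : A → A) (X : Matrix m n A) : Matrix n m A :=
  (X.map π).transpose

/-- The matrix `G = [[0, I₂], [-I₂, 0]]` of the symplectic form. -/
def Gmat (A : Type*) [Ring A] : Matrix (Fin 2 ⊕ Fin 2) (Fin 2 ⊕ Fin 2) A :=
  Matrix.fromBlocks 0 1 (-1) 0

/-- `𝔭₂(A,π) = {X ∈ Mat₄(A) : Xᴴ G + G X = 0}`. -/
def p2Set {A : Type*} [Ring A] (π : A → A) :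
    Set (Matrix (Fin 2 ⊕ Fin 2) (Fin 2 ⊕ Fin 2) A) :=
  {X | conjT π X * Gmat A + Gmat A * X = 0}

open Matrix in
theorem trace_mul_sub_mul_mem_span {k A n : Type*} [CommRing k] [Ring A] [Algebra k A] [Fintype n]
    (X Y : Matrix n n A) :
    (X * Y - Y * X).trace ∈ Submodule.span k {z : A | ∃ a b : A, z = a * b - b * a} := by
  have h : (X * Y - Y * X).trace = ∑ i, ∑ j, (X i j * Y j i - Y j i * X i j) := by
    rw [trace_sub]
    simp only [trace, diag_apply, mul_apply, Finset.sum_sub_distrib]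
    rw [Finset.sum_comm (f := fun i j => Y i j * X j i)]
  rw [h]
  exact Submodule.sum_mem _ fun i _ => Submodule.sum_mem _ fun j _ =>
    Submodule.subset_span ⟨_, _, rfl⟩

theorem fromBlocks_sub_fromBlocks {A l m n o : Type*} [AddGroup A] (P P' : Matrix n l A)
    (Q Q' : Matrix n m A) (R R' : Matrix o l A) (S S' : Matrix o m A) :
    Matrix.fromBlocks P Q R S - Matrix.fromBlocks P' Q' R' S' =
      Matrix.fromBlocks (P - P') (Q - Q') (R - R') (S - S') := by
  ext (i | i) (j | j) <;> rfl

section Involution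

variable {k A : Type*} [CommRing k] [Ring A] [Algebra k A] (φ : A →ₗ[k] A)

theorem conjT_zero {m n : Type*} : conjT φ (0 : Matrix m n A) = 0 := by
  ext; simp [conjT]

theorem conjT_add {m n : Type*} (X Y : Matrix m n A) :
    conjT φ (X + Y) = conjT φ X + conjT φ Y := by
  ext; simp [conjT]

theorem conjT_sub {m n : Type*} (X Y : Matrix m n A) :
    conjT φ (X - Y) = conjT φ X - conjT φ Y := by
  ext; simp [conjT]

theorem conjT_smul {m n : Type*} (c : k) (X : Matrix m n A) :
    conjT φ (c • X) = c • conjT φ X := by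
  ext; simp [conjT]

theorem conjT_mul (hφ : ∀ a b : A, φ (a * b) = φ b * φ a) {l m n : Type*} [Fintype m]
    (X : Matrix l m A) (Y : Matrix m n A) : conjT φ (X * Y) = conjT φ Y * conjT φ X := by
  ext; simp [conjT, Matrix.mul_apply, hφ]

theorem conjT_conjT (hinv : ∀ a : A, φ (φ a) = a) {m n : Type*} (X : Matrix m n A) :
    conjT φ (conjT φ X) = X := by
  ext; simp [conjT, hinv]

/-- `𝔭₂(A,φ)` as a `k`-submodule of the matrix algebra. -/
def p2Submodule : Submodule k (Matrix (Fin 2 ⊕ Fin 2) (Fin 2 ⊕ Fin 2) A) where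
  carrier := p2Set φ
  zero_mem' := by
    simp [p2Set, conjT_zero]
  add_mem' := by
    intro X Y hX hY
    simp only [p2Set, Set.mem_ofPred_eq] at hX hY ⊢
    rw [conjT_add, add_mul, mul_add, add_add_add_comm, hX, hY, add_zero]
  smul_mem' := by
    intro c X hX
    simp only [p2Set, Set.mem_ofPred_eq] at hX ⊢
    rw [conjT_smul, smul_mul_assoc, mul_smul_comm, ← smul_add, hX, smul_zero]

theorem mul_sub_mul_mem_p2Set (hφ : ∀ a b : A, φ (a * b) = φ b * φ a)
    {X Y : Matrix (Fin 2 ⊕ Fin 2) (Fin 2 ⊕ Fin 2) A} (hX : X ∈ p2Set φ) (hY : Y ∈ p2Set φ) :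
    X * Y - Y * X ∈ p2Set φ := by
  simp only [p2Set, Set.mem_ofPred_eq] at hX hY ⊢
  rw [add_eq_zero_iff_eq_neg] at hX hY
  rw [conjT_sub, conjT_mul φ hφ, conjT_mul φ hφ, sub_mul, mul_assoc, mul_assoc, hX, hY,
    mul_neg, mul_neg, ← mul_assoc, ← mul_assoc, hX, hY]
  noncomm_ring

theorem conjT_fromBlocks (P Q R S : Matrix (Fin 2) (Fin 2) A) :
    conjT φ (Matrix.fromBlocks P Q R S) =
      Matrix.fromBlocks (conjT φ P) (conjT φ R) (conjT φ Q) (conjT φ S) := by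
  ext (i | i) (j | j) <;> rfl

theorem fromBlocks_mem_p2Set_iff (hinv : ∀ a : A, φ (φ a) = a)
    (P Q R S : Matrix (Fin 2) (Fin 2) A) :
    Matrix.fromBlocks P Q R S ∈ p2Set φ ↔
      conjT φ Q = Q ∧ conjT φ R = R ∧ S = -conjT φ P := by
  have hneg : ∀ X : Matrix (Fin 2) (Fin 2) A, conjT φ (-X) = -conjT φ X := by
    intro X; ext; simp [conjT]
  rw [p2Set, Set.mem_ofPred_eq, conjT_fromBlocks, Gmat, Matrix.fromBlocks_multiply,
    Matrix.fromBlocks_multiply, Matrix.fromBlocks_add, ← Matrix.fromBlocks_zero,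
    Matrix.fromBlocks_inj]
  simp only [mul_zero, zero_mul, mul_one, one_mul, mul_neg, neg_mul, zero_add, add_zero]
  constructor
  · rintro ⟨hR, hS, -, hQ⟩
    exact ⟨add_neg_eq_zero.mp hQ, (neg_add_eq_zero.mp hR), (neg_eq_of_add_eq_zero_right hS).symm⟩
  · rintro ⟨hQ, hR, rfl⟩
    simp [hQ, hR, hneg, conjT_conjT φ hinv]

/-- The `k`-span of the commutators of elements of `𝔭₂(A,φ)`. -/
abbrev p2Commutators : Submodule k (Matrix (Fin 2 ⊕ Fin 2) (Fin 2 ⊕ Fin 2) A) :=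
  Submodule.span k {Z | ∃ X ∈ p2Set φ, ∃ Y ∈ p2Set φ, Z = X * Y - Y * X}

/-- The embedding `P ↦ diag(P, -Pᴴ)` of `Mat₂(A)` into `𝔭₂(A,φ)`. -/
def leviEmbedding :
    Matrix (Fin 2) (Fin 2) A →ₗ[k] Matrix (Fin 2 ⊕ Fin 2) (Fin 2 ⊕ Fin 2) A where
  toFun P := Matrix.fromBlocks P 0 0 (-conjT φ P)
  map_add' P P' := by
    rw [conjT_add, Matrix.fromBlocks_add, neg_add, add_zero]
  map_smul' c P := by
    rw [conjT_smul, RingHom.id_apply, Matrix.fromBlocks_smul, smul_neg, smul_zero]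

theorem leviEmbedding_mem_p2Set (hinv : ∀ a : A, φ (φ a) = a) (P : Matrix (Fin 2) (Fin 2) A) :
    leviEmbedding φ P ∈ p2Set φ :=
  (fromBlocks_mem_p2Set_iff φ hinv _ _ _ _).2 ⟨conjT_zero φ, conjT_zero φ, rfl⟩

theorem upper_mem_p2Set (hinv : ∀ a : A, φ (φ a) = a) {Q : Matrix (Fin 2) (Fin 2) A}
    (hQ : conjT φ Q = Q) : Matrix.fromBlocks 0 Q 0 0 ∈ p2Set φ :=
  (fromBlocks_mem_p2Set_iff φ hinv _ _ _ _).2 ⟨hQ, conjT_zero φ, by simp [conjT_zero]⟩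

theorem lower_mem_p2Set (hinv : ∀ a : A, φ (φ a) = a) {R : Matrix (Fin 2) (Fin 2) A}
    (hR : conjT φ R = R) : Matrix.fromBlocks 0 0 R 0 ∈ p2Set φ :=
  (fromBlocks_mem_p2Set_iff φ hinv _ _ _ _).2 ⟨conjT_zero φ, hR, by simp [conjT_zero]⟩

theorem leviEmbedding_mul_mem (hφ : ∀ a b : A, φ (a * b) = φ b * φ a)
    (hinv : ∀ a : A, φ (φ a) = a) {Q R : Matrix (Fin 2) (Fin 2) A}
    (hQ : conjT φ Q = Q) (hR : conjT φ R = R) :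
    leviEmbedding φ (Q * R) ∈ p2Commutators φ := by
  refine Submodule.subset_span
    ⟨_, upper_mem_p2Set φ hinv hQ, _, lower_mem_p2Set φ hinv hR, ?_⟩
  simp [leviEmbedding, conjT_mul φ hφ, hQ, hR, Matrix.fromBlocks_multiply, fromBlocks_sub_fromBlocks]

theorem leviEmbedding_commutator_mem (hφ : ∀ a b : A, φ (a * b) = φ b * φ a)
    (hinv : ∀ a : A, φ (φ a) = a) (P P' : Matrix (Fin 2) (Fin 2) A) :
    leviEmbedding φ (P * P' - P' * P) ∈ p2Commutators φ := by
  refine Submodule.subset_span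
    ⟨_, leviEmbedding_mem_p2Set φ hinv P, _, leviEmbedding_mem_p2Set φ hinv P', ?_⟩
  simp [leviEmbedding, conjT_mul φ hφ, conjT_sub, Matrix.fromBlocks_multiply,
    fromBlocks_sub_fromBlocks]

theorem conjT_one (hone : φ 1 = 1) {n : Type*} [DecidableEq n] :
    conjT φ (1 : Matrix n n A) = 1 := by
  ext i j
  simp [conjT, Matrix.one_apply, hone, eq_comm]

theorem upper_mem_p2Commutators (hone : φ 1 = 1) (hinv : ∀ a : A, φ (φ a) = a) {c : k}
    (hc : 2 * c = 1) {Q : Matrix (Fin 2) (Fin 2) A} (hQ : conjT φ Q = Q) :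
    Matrix.fromBlocks 0 Q 0 0 ∈ p2Commutators φ := by
  refine Submodule.subset_span
    ⟨_, leviEmbedding_mem_p2Set φ hinv (c • 1), _, upper_mem_p2Set φ hinv hQ, ?_⟩
  have h : Q = c • Q + c • Q := by rw [← two_smul k, smul_smul, hc, one_smul]
  simpa [leviEmbedding, conjT_smul, conjT_one φ hone, Matrix.fromBlocks_multiply,
    Matrix.fromBlocks_smul, fromBlocks_sub_fromBlocks, Matrix.fromBlocks_inj] using h

theorem lower_mem_p2Commutators (hone : φ 1 = 1) (hinv : ∀ a : A, φ (φ a) = a) {c : k}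
    (hc : 2 * c = 1) {R : Matrix (Fin 2) (Fin 2) A} (hR : conjT φ R = R) :
    Matrix.fromBlocks 0 0 R 0 ∈ p2Commutators φ := by
  refine Submodule.subset_span
    ⟨_, lower_mem_p2Set φ hinv hR, _, leviEmbedding_mem_p2Set φ hinv (c • 1), ?_⟩
  have h : R = c • R + c • R := by rw [← two_smul k, smul_smul, hc, one_smul]
  simpa [leviEmbedding, conjT_smul, conjT_one φ hone, Matrix.fromBlocks_multiply,
    Matrix.fromBlocks_smul, fromBlocks_sub_fromBlocks, Matrix.fromBlocks_inj] using h

theorem leviEmbedding_single_mem_of_mem_span (hφ : ∀ a b : A, φ (a * b) = φ b * φ a)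
    (hinv : ∀ a : A, φ (φ a) = a) {s : A}
    (hs : s ∈ Submodule.span k {z : A | ∃ a b : A, z = a * b - b * a}) :
    leviEmbedding φ !![s, 0; 0, 0] ∈ p2Commutators φ := by
  have hle : Submodule.span k {z : A | ∃ a b : A, z = a * b - b * a} ≤
      (p2Commutators φ).comap (leviEmbedding φ ∘ₗ Matrix.singleLinearMap k 0 0) := by
    refine Submodule.span_le.2 ?_
    rintro _ ⟨a, b, rfl⟩
    have h := leviEmbedding_commutator_mem φ hφ hinv (Matrix.single 0 0 a) (Matrix.single 0 0 b)
    rw [Matrix.single_mul_single_same, Matrix.single_mul_single_same] at h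
    simpa only [Submodule.comap_coe, Set.mem_preimage, LinearMap.comp_apply, map_sub,
      Matrix.singleLinearMap_apply, SetLike.mem_coe] using h
  have h := hle hs
  have hsingle : Matrix.single (0 : Fin 2) (0 : Fin 2) s = !![s, 0; 0, 0] := by
    ext i j; fin_cases i <;> fin_cases j <;> simp [Matrix.single]
  simpa [hsingle] using h

theorem leviEmbedding_mem (hφ : ∀ a b : A, φ (a * b) = φ b * φ a) (hone : φ 1 = 1)
    (hinv : ∀ a : A, φ (φ a) = a) {c : k} (hc : 2 * c = 1) (P : Matrix (Fin 2) (Fin 2) A)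
    (hP : (leviEmbedding φ P).trace ∈ Submodule.span k {z : A | ∃ a b : A, z = a * b - b * a}) :
    leviEmbedding φ P ∈ p2Commutators φ := by
  have herm : ∀ a x d : A, φ a = a → φ d = d →
      conjT φ !![a, x; φ x, d] = !![a, x; φ x, d] := by
    intro a x d ha hd
    ext i j; fin_cases i <;> fin_cases j <;> simp [conjT, ha, hd, hinv]
  have hz : φ 0 = 0 := map_zero φ
  have hflip : conjT φ !![0, 1; 1, 0] = !![0, 1; 1, 0] := by
    simpa [hone] using herm 0 1 0 hz hz
  have hE₁ : conjT φ !![1, 0; 0, 0] = !![1, 0; 0, 0] := by simpa using herm 1 0 0 hone hz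
  have hE₂ : conjT φ !![0, 0; 0, 1] = !![0, 0; 0, 1] := by simpa using herm 0 0 1 hz hone
  set b := P 0 0 - φ (P 1 1) with hb
  have htr : (leviEmbedding φ P).trace = b - φ b := by
    simp [leviEmbedding, Matrix.trace, conjT, hb, hinv, Fin.sum_univ_two]
    abel
  rw [htr] at hP
  have hsym : φ (c • (b + φ b)) = c • (b + φ b) := by simp [hinv, add_comm]
  have hhalf : b = c • (b + φ b) + c • (b - φ b) := by
    rw [← smul_add, add_add_sub_cancel, ← two_smul k, smul_smul, mul_comm, hc, one_smul]
  have h₁ := leviEmbedding_mul_mem φ hφ hinv (herm 0 (P 0 1) 0 hz hz) hE₂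
  have h₂ := leviEmbedding_mul_mem φ hφ hinv (herm 0 (φ (P 1 0)) 0 hz hz) hE₁
  have h₃ := leviEmbedding_mul_mem φ hφ hinv (herm 0 (φ (P 1 1)) 0 hz hz) hflip
  have h₄ := leviEmbedding_mul_mem φ hφ hinv (herm _ 0 0 hsym hz) hE₁
  have h₅ := leviEmbedding_single_mem_of_mem_span φ hφ hinv (Submodule.smul_mem _ c hP)
  have hsum := add_mem (add_mem (add_mem (add_mem h₁ h₂) h₃) h₄) h₅
  simp only [← map_add] at hsum
  convert hsum using 2
  ext i j
  fin_cases i <;> fin_cases j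
  · simp [-smul_add]
    rw [add_assoc, ← hhalf, hb]
    abel
  all_goals simp [hinv]

end Involution

/-- For `2, 3` invertible in `k`, `𝔰𝔲₂(A,π) = {X ∈ 𝔭₂(A,π) : tr X ∈ [A,A]}` equals
`[𝔭₂(A,π), 𝔭₂(A,π)]`, the `k`-span of all commutators of elements of `𝔭₂(A,π)`. -/
theorem su2_eq_commutator_span_p2
    {k : Type*} [CommRing k] (h2 : IsUnit (2 : k)) (h3 : IsUnit (3 : k))
    {A : Type*} [Ring A] [Algebra k A]
    (π : A → A)
    (hπadd : ∀ a b : A, π (a + b) = π a + π b)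
    (hπsmul : ∀ (c : k) (a : A), π (c • a) = c • π a)
    (hπmul : ∀ a b : A, π (a * b) = π b * π a)
    (hπone : π 1 = 1)
    (hπinv : ∀ a : A, π (π a) = a) :
    {X : Matrix (Fin 2 ⊕ Fin 2) (Fin 2 ⊕ Fin 2) A |
        X ∈ p2Set π ∧ X.trace ∈ Submodule.span k {z : A | ∃ a b : A, z = a * b - b * a}}
      = (Submodule.span k
          {Z : Matrix (Fin 2 ⊕ Fin 2) (Fin 2 ⊕ Fin 2) A |
            ∃ X ∈ p2Set π, ∃ Y ∈ p2Set π, Z = X * Y - Y * X} : Set _) := by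
  obtain ⟨c, hc⟩ := h2.exists_right_inv
  obtain ⟨φ, rfl⟩ : ∃ φ : A →ₗ[k] A, ⇑φ = π :=
    ⟨{ toFun := π, map_add' := hπadd, map_smul' := hπsmul }, rfl⟩
  ext X
  constructor
  · rintro ⟨hX, htr⟩
    obtain ⟨P, Q, R, S, rfl⟩ : ∃ P Q R S, X = Matrix.fromBlocks P Q R S :=
      ⟨_, _, _, _, X.fromBlocks_toBlocks.symm⟩
    obtain ⟨hQ, hR, rfl⟩ := (fromBlocks_mem_p2Set_iff φ hπinv _ _ _ _).1 hX
    have hdecomp : Matrix.fromBlocks P Q R (-conjT φ P) =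
        leviEmbedding φ P + Matrix.fromBlocks 0 Q 0 0 + Matrix.fromBlocks 0 0 R 0 := by
      simp [leviEmbedding, Matrix.fromBlocks_add]
    have htrace : (Matrix.fromBlocks P Q R (-conjT φ P)).trace = (leviEmbedding φ P).trace := by
      simp [leviEmbedding, Matrix.trace]
    rw [htrace] at htr
    rw [SetLike.mem_coe, hdecomp]
    exact add_mem (add_mem (leviEmbedding_mem φ hπmul hπone hπinv hc P htr)
      (upper_mem_p2Commutators φ hπone hπinv hc hQ)) (lower_mem_p2Commutators φ hπone hπinv hc hR)
  · intro hX
    have hle : p2Commutators φ ≤ p2Submodule φ ⊓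
        (Submodule.span k {z : A | ∃ a b : A, z = a * b - b * a}).comap
          (Matrix.traceLinearMap (Fin 2 ⊕ Fin 2) k A) := by
      refine Submodule.span_le.2 ?_
      rintro _ ⟨X, hX, Y, hY, rfl⟩
      exact ⟨mul_sub_mul_mem_p2Set φ hπmul hX hY, trace_mul_sub_mul_mem_span X Y⟩
    exact hle hX
end

section
/- Let k be a commutative ring in which 2 and 3 are invertible and A a unital associative k-algebra with k-linear involution π. Assume A = Z(A) ⊕ [A,A] as k-modules, where Z(A) is the centre of A and [A,A] the k-span of {ab − ba : a, b ∈ A}. Then the Lie algebra 𝔰𝔲₂(A,π) = {X ∈ 𝔭₂(A,π) : tr(X) ∈ [A,A]} is centreless: if X ∈ 𝔰𝔲₂(A,π) satisfies XY − YX = 0 for all Y ∈ 𝔰𝔲₂(A,π), then X = 0. -/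
/-- Strictly upper block triangular matrices with `π`-hermitian corner lie in `𝔭₂(A,π)`. -/
theorem fromBlocks_upper_mem_p2Set {A : Type*} [Ring A] {π : A → A} (hπzero : π 0 = 0)
    {B : Matrix (Fin 2) (Fin 2) A} (hB : conjT π B = B) :
    Matrix.fromBlocks 0 B 0 0 ∈ p2Set π := by
  have h0 : (0 : Matrix (Fin 2) (Fin 2) A).map π = 0 := by ext; simp [hπzero]
  have hB' : (B.map π).transpose = B := hB
  simp [p2Set, conjT, Gmat, Matrix.fromBlocks_map, Matrix.fromBlocks_transpose,
    Matrix.fromBlocks_multiply, Matrix.fromBlocks_add, h0, hB']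

/-- Strictly lower block triangular matrices with `π`-hermitian corner lie in `𝔭₂(A,π)`. -/
theorem fromBlocks_lower_mem_p2Set {A : Type*} [Ring A] {π : A → A} (hπzero : π 0 = 0)
    {C : Matrix (Fin 2) (Fin 2) A} (hC : conjT π C = C) :
    Matrix.fromBlocks 0 0 C 0 ∈ p2Set π := by
  have h0 : (0 : Matrix (Fin 2) (Fin 2) A).map π = 0 := by ext; simp [hπzero]
  have hC' : (C.map π).transpose = C := hC
  simp [p2Set, conjT, Gmat, Matrix.fromBlocks_map, Matrix.fromBlocks_transpose,
    Matrix.fromBlocks_multiply, Matrix.fromBlocks_add, h0, hC']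

/-- A `2 × 2` matrix commuting with all `π`-hermitian matrices is a central scalar. -/
theorem eq_central_scalar_of_commute_hermitian {A : Type*} [Ring A] {π : A → A}
    (hπzero : π 0 = 0) (hπone : π 1 = 1) (hπinv : ∀ a : A, π (π a) = a)
    {P : Matrix (Fin 2) (Fin 2) A}
    (hP : ∀ B : Matrix (Fin 2) (Fin 2) A, conjT π B = B → P * B = B * P) :
    ∃ p : A, (∀ a : A, p * a = a * p) ∧ P = !![p, 0; 0, p] := by
  have hdiag := hP !![1, 0; 0, 0] (by
    ext i j; fin_cases i <;> fin_cases j <;> simp [conjT, hπzero, hπone])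
  have hanti : ∀ a : A, P * !![0, a; π a, 0] = !![0, a; π a, 0] * P := fun a =>
    hP _ (by ext i j; fin_cases i <;> fin_cases j <;> simp [conjT, hπzero, hπinv])
  have h01 : P 0 1 = 0 := by
    simpa [Matrix.mul_apply, Fin.sum_univ_two] using (congrFun (congrFun hdiag 0) 1).symm
  have h10 : P 1 0 = 0 := by
    simpa [Matrix.mul_apply, Fin.sum_univ_two] using congrFun (congrFun hdiag 1) 0
  have hmul : ∀ a : A, P 0 0 * a = a * P 1 1 := fun a => by
    simpa [Matrix.mul_apply, Fin.sum_univ_two] using congrFun (congrFun (hanti a) 0) 1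
  have h11 : P 1 1 = P 0 0 := by simpa using (hmul 1).symm
  refine ⟨P 0 0, fun a => by rw [hmul a, h11], ?_⟩
  ext i j
  fin_cases i <;> fin_cases j <;> simp [h01, h10, h11]

/-- If `A = Z(A) ⊕ [A,A]` as `k`-modules (with `2, 3` invertible in `k`), then the Lie
algebra `𝔰𝔲₂(A,π)` is centreless. -/
theorem su2_centreless
    {k : Type*} [CommRing k] (h2 : IsUnit (2 : k)) (h3 : IsUnit (3 : k))
    {A : Type*} [Ring A] [Algebra k A]
    (π : A → A)
    (hπadd : ∀ a b : A, π (a + b) = π a + π b)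
    (hπsmul : ∀ (c : k) (a : A), π (c • a) = c • π a)
    (hπmul : ∀ a b : A, π (a * b) = π b * π a)
    (hπone : π 1 = 1)
    (hπinv : ∀ a : A, π (π a) = a)
    (hsup : Subalgebra.toSubmodule (Subalgebra.center k A)
        ⊔ Submodule.span k {z : A | ∃ a b : A, z = a * b - b * a} = ⊤)
    (hinf : Subalgebra.toSubmodule (Subalgebra.center k A)
        ⊓ Submodule.span k {z : A | ∃ a b : A, z = a * b - b * a} = ⊥) :
    ∀ X : Matrix (Fin 2 ⊕ Fin 2) (Fin 2 ⊕ Fin 2) A,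
      X ∈ p2Set π →
      X.trace ∈ Submodule.span k {z : A | ∃ a b : A, z = a * b - b * a} →
      (∀ Y : Matrix (Fin 2 ⊕ Fin 2) (Fin 2 ⊕ Fin 2) A,
        Y ∈ p2Set π →
        Y.trace ∈ Submodule.span k {z : A | ∃ a b : A, z = a * b - b * a} →
        X * Y - Y * X = 0) →
      X = 0 := by
  intro X _ htr hX
  have hπzero : π 0 = 0 := by simpa using hπadd 0 0
  have hone : conjT π (1 : Matrix (Fin 2) (Fin 2) A) = 1 := by
    rw [conjT, Matrix.map_one π hπzero hπone, Matrix.transpose_one]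
  obtain ⟨P, Q, R, S, rfl⟩ : ∃ P Q R S, X = Matrix.fromBlocks P Q R S :=
    ⟨_, _, _, _, (Matrix.fromBlocks_toBlocks X).symm⟩
  have hupper : ∀ B : Matrix (Fin 2) (Fin 2) A, conjT π B = B → P * B = B * S ∧ R * B = 0 := by
    intro B hB
    have h := sub_eq_zero.mp (hX _ (fromBlocks_upper_mem_p2Set hπzero hB)
      (by simp [Matrix.trace, Fintype.sum_sum_type]))
    simp only [Matrix.fromBlocks_multiply, Matrix.fromBlocks_inj] at h
    simpa using And.intro h.2.1 h.2.2.2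
  have hlower := sub_eq_zero.mp (hX _ (fromBlocks_lower_mem_p2Set hπzero hone)
    (by simp [Matrix.trace, Fintype.sum_sum_type]))
  simp only [Matrix.fromBlocks_multiply, Matrix.fromBlocks_inj] at hlower
  have hQ : Q = 0 := by simpa using hlower.1
  have hPS : P = S := by simpa using (hupper 1 hone).1
  have hR : R = 0 := by simpa using (hupper 1 hone).2
  subst hPS hQ hR
  obtain ⟨p, hp, rfl⟩ := eq_central_scalar_of_commute_hermitian hπzero hπone hπinv
    fun B hB => (hupper B hB).1
  have hfour : (4 : k) • p = 0 := by
    have hmem : (4 : k) • p ∈ Subalgebra.toSubmodule (Subalgebra.center k A)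
        ⊓ Submodule.span k {z : A | ∃ a b : A, z = a * b - b * a} := by
      refine ⟨Submodule.smul_mem _ _ ((Subalgebra.mem_center_iff (R := k)).mpr fun a => (hp a).symm), ?_⟩
      have htrace : (Matrix.fromBlocks !![p, 0; 0, p] 0 0 !![p, 0; 0, p]).trace = (4 : k) • p := by
        simp only [Matrix.trace, Fintype.sum_sum_type, Matrix.diag_apply, Fin.sum_univ_two,
          Matrix.fromBlocks_apply₁₁, Matrix.fromBlocks_apply₂₂, Matrix.of_apply,
          Matrix.cons_val_zero, Matrix.cons_val_one]
        module
      rwa [htrace] at htr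
    rwa [hinf, Submodule.mem_bot] at hmem
  have hp0 : p = 0 := by
    have h4 : IsUnit (4 : k) := by
      have h := h2.mul h2
      norm_num at h
      exact h
    exact h4.smul_eq_zero.mp hfour
  subst hp0
  ext i j
  rcases i with i | i <;> rcases j with j | j <;> fin_cases i <;> fin_cases j <;> simp
end
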